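/- There exists θ > 0 such that |ζ(1/2 − s̄)| ≤ θ |ζ(1/2 + s)| for all s in D(t₀, K) := {x + it : t ≥ t₀, 0 ≤ x ≤ K/log t}, for any fixed t₀ > 1 and K ≥ 0. (Here s̄ denotes complex conjugation.) -/

import Mathlib

open Complex

/-- The Gamma function on the right half-plane is dominated by its values on the real axis. -/
lemma norm_Gamma_le_Gamma_re {s : ℂ} (hs : 0 < s.re) : ‖Gamma s‖ ≤ Real.Gamma s.re := by
  rw [Gamma_eq_integral hs, GammaIntegral, Real.Gamma_eq_integral hs]
  refine (MeasureTheory.norm_integral_le_integral_norm _).trans (le_of_eq ?_)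
  refine MeasureTheory.setIntegral_congr_fun measurableSet_Ioi fun x hx ↦ ?_
  simp only [norm_mul, norm_real, Real.norm_eq_abs, Real.abs_exp]
  rw [norm_cpow_eq_rpow_re_of_pos hx, sub_re, one_re]

/-- On the critical line, `|Γ(1/2 + it)| = O(exp(-πt/2))`. -/
lemma norm_Gamma_mul_exp_le_of_re_eq_half {z : ℂ} (hz : z.re = 1 / 2) :
    ‖Gamma z‖ * Real.exp (Real.pi * z.im / 2) ≤ √(2 * Real.pi) := by
  apply Real.le_sqrt_of_sq_le
  have hconj : 1 - z = (starRingEnd ℂ) z := by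
    apply Complex.ext <;> simp [hz]
    norm_num
  have hsin : sin (Real.pi * z) = (Real.cosh (Real.pi * z.im) : ℝ) := by
    have : Real.pi * z = ((Real.pi * z.im : ℝ) : ℂ) * I + Real.pi / 2 := by
      apply Complex.ext <;> simp [hz]
      ring
    rw [this, Complex.sin_add_pi_div_two, Complex.cos_mul_I, Complex.ofReal_cosh]
  have h := congrArg norm (Gamma_mul_Gamma_one_sub z)
  rw [hconj, Gamma_conj, norm_mul, norm_conj, hsin, norm_div, norm_real, norm_real,
    Real.norm_of_nonneg Real.pi_pos.le, Real.norm_of_nonneg (Real.cosh_pos _).le] at h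
  have hexp : Real.exp (Real.pi * z.im / 2) ^ 2 = Real.exp (Real.pi * z.im) := by
    rw [← Real.exp_nat_mul]; congr 1; push_cast; ring
  rw [mul_pow, sq ‖Gamma z‖, h, hexp, div_mul_eq_mul_div, div_le_iff₀ (Real.cosh_pos _),
    Real.cosh_eq]
  nlinarith [Real.pi_pos, mul_pos Real.pi_pos (Real.exp_pos (-(Real.pi * z.im)))]

lemma norm_Gamma_add_natCast_le {z : ℂ} (hz : 0 < z.re) (n : ℕ) :
    ‖Gamma (z + n)‖ ≤ (‖z‖ + n) ^ n * ‖Gamma z‖ := by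
  induction n with
  | zero => simp
  | succ k ih =>
    have hne : z + k ≠ 0 := fun h ↦ by
      have := congrArg re h
      simp only [add_re, natCast_re, zero_re] at this
      linarith [(Nat.cast_nonneg k : (0 : ℝ) ≤ k)]
    have hnorm : ‖z + k‖ ≤ ‖z‖ + k := by simpa using norm_add_le z (k : ℂ)
    rw [Nat.cast_succ, ← add_assoc, Gamma_add_one _ hne, norm_mul]
    calc ‖z + k‖ * ‖Gamma (z + k)‖ ≤ (‖z‖ + k) * ((‖z‖ + k) ^ k * ‖Gamma z‖) := by gcongr
      _ = (‖z‖ + k) ^ (k + 1) * ‖Gamma z‖ := by ring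
      _ ≤ (‖z‖ + (k + 1 : ℕ)) ^ (k + 1) * ‖Gamma z‖ := by gcongr; omega
      _ = _ := by push_cast; rfl

/-- The Gamma function shifted to height `T` and normalised so that it is bounded on the strips
`0 ≤ re w ≤ n` uniformly in `T ≥ 1`. -/
noncomputable def shiftedGamma (T : ℝ) (w : ℂ) : ℂ :=
  Gamma (1 / 2 + w + T * I) *
    exp (-I * Real.pi * (w + T * I) / 2 - w * Real.log T + w ^ 2)

lemma norm_shiftedGamma (T : ℝ) (w : ℂ) :
    ‖shiftedGamma T w‖ = ‖Gamma (1 / 2 + w + T * I)‖ *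
      Real.exp (Real.pi * (T + w.im) / 2 - w.re * Real.log T + w.re ^ 2 - w.im ^ 2) := by
  rw [shiftedGamma, norm_mul, norm_exp]
  congr 2
  simp [sq]
  ring

lemma differentiableAt_shiftedGamma (T : ℝ) {w : ℂ} (hw : 0 ≤ w.re) :
    DifferentiableAt ℂ (shiftedGamma T) w := by
  have hG : DifferentiableAt ℂ Gamma (1 / 2 + w + T * I) := by
    refine differentiableAt_Gamma _ fun m h ↦ ?_
    have := congrArg re h
    simp at this
    linarith [(Nat.cast_nonneg m : (0 : ℝ) ≤ m)]
  unfold shiftedGamma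
  refine DifferentiableAt.mul ?_ (by fun_prop)
  exact hG.comp w (f := fun w ↦ 1 / 2 + w + T * I) (by fun_prop)

lemma norm_shiftedGamma_le_of_re_eq_zero {T : ℝ} {w : ℂ} (hw : w.re = 0) :
    ‖shiftedGamma T w‖ ≤ √(2 * Real.pi) := by
  have h := norm_Gamma_mul_exp_le_of_re_eq_half (z := 1 / 2 + w + T * I) (by simp [hw])
  rw [norm_shiftedGamma]
  refine le_trans ?_ h
  gcongr
  simp [hw]
  nlinarith [sq_nonneg w.im]

lemma norm_shiftedGamma_le_of_re_eq_natCast {T : ℝ} (hT : 1 ≤ T) {n : ℕ} {w : ℂ}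
    (hw : w.re = n) :
    ‖shiftedGamma T w‖ ≤ √(2 * Real.pi) * Real.exp (n * (n + 2) + 2 * n ^ 2) := by
  have hT0 : 0 < T := by linarith
  set z : ℂ := 1 / 2 + (w - n) + T * I with hz
  have hzre : z.re = 1 / 2 := by simp [hz, hw]
  have hzim : z.im = T + w.im := by simp [hz]; ring
  have h := norm_Gamma_mul_exp_le_of_re_eq_half hzre
  have hG : ‖Gamma (1 / 2 + w + T * I)‖ ≤ (‖z‖ + n) ^ n * ‖Gamma z‖ := by
    rw [show (1 / 2 + w + T * I : ℂ) = z + n by rw [hz]; ring]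
    exact norm_Gamma_add_natCast_le (by rw [hzre]; norm_num) n
  have hznorm : ‖z‖ ≤ 1 / 2 + (T + |w.im|) := by
    refine (norm_le_abs_re_add_abs_im z).trans ?_
    rw [hzre, hzim, abs_of_pos (by norm_num : (0 : ℝ) < 1 / 2)]
    gcongr
    exact (abs_add_le _ _).trans (by rw [abs_of_pos hT0])
  have hbase : ‖z‖ + n ≤ T * Real.exp (n + 2 + |w.im|) := by
    have h1 := Real.add_one_le_exp (n + 2 + |w.im|)
    have h2 : (0 : ℝ) ≤ n := Nat.cast_nonneg n
    have h3 := abs_nonneg w.im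
    nlinarith
  have hpow : (‖z‖ + n) ^ n ≤ Real.exp (n * Real.log T + n * (n + 2 + |w.im|)) := by
    calc (‖z‖ + n) ^ n ≤ (T * Real.exp (n + 2 + |w.im|)) ^ n := by gcongr
      _ = _ := by
        rw [Real.exp_add (n * _), Real.exp_nat_mul, Real.exp_nat_mul, Real.exp_log hT0, mul_pow]
  rw [norm_shiftedGamma]
  calc ‖Gamma (1 / 2 + w + T * I)‖ *
        Real.exp (Real.pi * (T + w.im) / 2 - w.re * Real.log T + w.re ^ 2 - w.im ^ 2)
      ≤ (Real.exp (n * Real.log T + n * (n + 2 + |w.im|)) * ‖Gamma z‖) *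
        Real.exp (Real.pi * (T + w.im) / 2 - w.re * Real.log T + w.re ^ 2 - w.im ^ 2) := by
        gcongr
        exact hG.trans (by gcongr)
    _ = (‖Gamma z‖ * Real.exp (Real.pi * z.im / 2)) *
        Real.exp (n * (n + 2) + n * |w.im| + n ^ 2 - w.im ^ 2) := by
        rw [mul_comm (Real.exp _) ‖Gamma z‖, mul_assoc, mul_assoc, ← Real.exp_add,
          ← Real.exp_add, hw, hzim]
        congr 2
        ring
    _ ≤ _ := by
        gcongr ?_ * Real.exp ?_
        rw [← sq_abs w.im]
        nlinarith [sq_nonneg (n - |w.im|), sq_nonneg |w.im|, sq_nonneg (n : ℝ)]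

lemma exists_norm_shiftedGamma_le (T : ℝ) (hT : 1 ≤ T) (n : ℕ) :
    ∃ M : ℝ, ∀ w : ℂ, 0 ≤ w.re → w.re ≤ n → ‖shiftedGamma T w‖ ≤ M := by
  have hcont : ContinuousOn Real.Gamma (Set.Icc (1 / 2) (1 / 2 + n)) :=
    Real.differentiableOn_Gamma_Ioi.continuousOn.mono fun x hx ↦ by
      have := hx.1
      simp only [Set.mem_Ioi]
      linarith
  obtain ⟨M, hM⟩ := isCompact_Icc.exists_bound_of_continuousOn hcont
  refine ⟨M * Real.exp (Real.pi * T / 2 + n ^ 2 + Real.pi ^ 2), fun w h0 h1 ↦ ?_⟩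
  have hre : (1 / 2 + w + T * I).re = 1 / 2 + w.re := by simp
  have hG : ‖Gamma (1 / 2 + w + T * I)‖ ≤ M := by
    refine (norm_Gamma_le_Gamma_re (by rw [hre]; linarith)).trans ?_
    rw [hre]
    exact (le_abs_self _).trans (hM _ ⟨by linarith, by linarith⟩)
  rw [norm_shiftedGamma]
  have hlog := mul_nonneg h0 (Real.log_nonneg hT)
  have hsq : w.re ^ 2 ≤ (n : ℝ) ^ 2 := by gcongr
  have hM0 : 0 ≤ M := (norm_nonneg _).trans hG
  gcongr ?_ * Real.exp ?_
  nlinarith [sq_nonneg (w.im - Real.pi / 4), sq_nonneg Real.pi]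

/-- Phragmén-Lindelöf bound for the shifted Gamma function, uniform in the height. -/
lemma norm_shiftedGamma_le {T : ℝ} (hT : 1 ≤ T) {n : ℕ} (hn : 0 < n) {w : ℂ}
    (h0 : 0 ≤ w.re) (h1 : w.re ≤ n) :
    ‖shiftedGamma T w‖ ≤ √(2 * Real.pi) * Real.exp (n * (n + 2) + 2 * n ^ 2) := by
  have hn' : (0 : ℝ) < n := Nat.cast_pos.mpr hn
  refine PhragmenLindelof.vertical_strip (a := 0) (b := n) ?_ ?_ (fun z hz ↦ ?_)
    (fun z hz ↦ norm_shiftedGamma_le_of_re_eq_natCast hT hz) h0 h1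
  · refine DifferentiableOn.diffContOnCl fun z hz ↦ ?_
    refine (differentiableAt_shiftedGamma T ?_).differentiableWithinAt
    have : closure (re ⁻¹' Set.Ioo (0 : ℝ) n) ⊆ re ⁻¹' Set.Icc (0 : ℝ) n :=
      closure_minimal (Set.preimage_mono Set.Ioo_subset_Icc_self)
        (isClosed_Icc.preimage continuous_re)
    exact (this hz).1
  · obtain ⟨M, hM⟩ := exists_norm_shiftedGamma_le T hT n
    refine ⟨0, by rw [sub_zero]; positivity, 0, Asymptotics.IsBigO.of_bound M ?_⟩
    refine Filter.Eventually.filter_mono inf_le_right (Filter.eventually_principal.mpr ?_)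
    intro z hz
    simpa using hM z hz.1.le hz.2.le
  · refine (norm_shiftedGamma_le_of_re_eq_zero hz).trans ?_
    exact le_mul_of_one_le_right (Real.sqrt_nonneg _) (Real.one_le_exp (by positivity))

/-- Upper Stirling bound `|Γ(1/2 + s)| = O(t ^ x * exp(-πt/2))` on vertical strips. -/
lemma exists_norm_Gamma_half_add_le {n : ℕ} (hn : 0 < n) :
    ∃ C : ℝ, 0 < C ∧ ∀ s : ℂ, 1 ≤ s.im → 0 ≤ s.re → s.re ≤ n →
      ‖Gamma (1 / 2 + s)‖ ≤ C * Real.exp (s.re * Real.log s.im - Real.pi * s.im / 2) := by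
  refine ⟨√(2 * Real.pi) * Real.exp (n * (n + 2) + 2 * n ^ 2), by positivity,
    fun s hs h0 h1 ↦ ?_⟩
  have h := norm_shiftedGamma_le hs hn (w := (s.re : ℂ)) (by simpa using h0) (by simpa using h1)
  rw [norm_shiftedGamma, add_assoc, re_add_im] at h
  simp only [ofReal_re, ofReal_im] at h
  have hsplit : ‖Gamma (1 / 2 + s)‖ =
      (‖Gamma (1 / 2 + s)‖ * Real.exp (Real.pi * s.im / 2 - s.re * Real.log s.im)) *
        Real.exp (s.re * Real.log s.im - Real.pi * s.im / 2) := by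
    rw [mul_assoc, ← Real.exp_add]
    simp
  rw [hsplit]
  refine mul_le_mul_of_nonneg_right (le_trans ?_ h) (Real.exp_pos _).le
  gcongr _ * Real.exp ?_
  nlinarith [sq_nonneg s.re]

lemma norm_cos_le_exp_abs_im (z : ℂ) : ‖cos z‖ ≤ Real.exp |z.im| := by
  rw [Complex.cos, norm_div, RCLike.norm_ofNat, div_le_iff₀ two_pos]
  have h1 : ‖exp (z * I)‖ ≤ Real.exp |z.im| := by
    rw [norm_exp]
    gcongr
    simpa using neg_le_abs z.im
  have h2 : ‖exp (-z * I)‖ ≤ Real.exp |z.im| := by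
    rw [norm_exp]
    gcongr
    simpa using le_abs_self z.im
  linarith [norm_add_le (exp (z * I)) (exp (-z * I))]

theorem zeta_reflection_bound (t₀ K : ℝ) (ht₀ : 1 < t₀) (hK : 0 ≤ K) :
    ∃ θ : ℝ, 0 < θ ∧
      ∀ s : ℂ, t₀ ≤ s.im → 0 ≤ s.re → s.re ≤ K / Real.log s.im →
        ‖riemannZeta (1 / 2 - (starRingEnd ℂ) s)‖ ≤ θ * ‖riemannZeta (1 / 2 + s)‖ := by
  obtain ⟨n, hn⟩ := exists_nat_ge (K / Real.log t₀)
  obtain ⟨C, hC, hGamma⟩ := exists_norm_Gamma_half_add_le n.succ_pos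
  refine ⟨2 * (C * Real.exp K), by positivity, fun s ht h0 hx ↦ ?_⟩
  have hlog₀ : 0 < Real.log t₀ := Real.log_pos ht₀
  have hlog : Real.log t₀ ≤ Real.log s.im := Real.log_le_log (by linarith) ht
  have hxn : s.re ≤ (n + 1 : ℕ) := by
    have : K / Real.log s.im ≤ K / Real.log t₀ := by gcongr
    push_cast
    linarith
  have hxlog : s.re * Real.log s.im ≤ K := (le_div_iff₀ (hlog₀.trans_le hlog)).mp hx
  have hconj : ‖riemannZeta (1 / 2 - (starRingEnd ℂ) s)‖ = ‖riemannZeta (1 - (1 / 2 + s))‖ := by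
    rw [← norm_conj, ← riemannZeta_conj]
    congr 2
    rw [map_sub, conj_conj, map_div₀, map_one, map_ofNat]
    ring
  have him : (1 / 2 + s).im = s.im := by simp
  have hre : (1 / 2 + s).re = 1 / 2 + s.re := by simp
  rw [hconj, riemannZeta_one_sub (fun m h ↦ ?_) (fun h ↦ ?_), norm_mul]
  · gcongr
    have hpow : ‖(2 * Real.pi : ℂ) ^ (-(1 / 2 + s))‖ ≤ 1 := by
      have hcast : (2 * Real.pi : ℂ) = ((2 * Real.pi : ℝ) : ℂ) := by push_cast; rfl
      rw [hcast, norm_cpow_eq_rpow_re_of_pos (by positivity), neg_re, hre]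
      exact Real.rpow_le_one_of_one_le_of_nonpos (by linarith [Real.two_le_pi]) (by linarith)
    have hcos : ‖cos (Real.pi * (1 / 2 + s) / 2)‖ ≤ Real.exp (Real.pi * s.im / 2) := by
      refine (norm_cos_le_exp_abs_im _).trans (le_of_eq ?_)
      have : (Real.pi * (1 / 2 + s) / 2 : ℂ).im = Real.pi * s.im / 2 := by simp
      rw [this, abs_of_nonneg]
      have : 0 < s.im := by linarith
      positivity
    have hΓ := hGamma s (by linarith) h0 hxn
    rw [norm_mul, norm_mul, norm_mul, RCLike.norm_ofNat]
    calc 2 * ‖(2 * Real.pi : ℂ) ^ (-(1 / 2 + s))‖ * ‖Gamma (1 / 2 + s)‖ *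
          ‖cos (Real.pi * (1 / 2 + s) / 2)‖
        ≤ 2 * 1 * (C * Real.exp (s.re * Real.log s.im - Real.pi * s.im / 2)) *
          Real.exp (Real.pi * s.im / 2) := by gcongr
      _ = 2 * (C * Real.exp (s.re * Real.log s.im)) := by
          rw [mul_assoc, mul_assoc C, ← Real.exp_add, sub_add_cancel, mul_one]
      _ ≤ 2 * (C * Real.exp K) := by gcongr
  · have := congrArg re h
    rw [hre] at this
    simp at this
    linarith [(Nat.cast_nonneg m : (0 : ℝ) ≤ m)]
  · have := congrArg im h
    rw [him, one_im] at this
    linarith
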